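/- arXiv:1805.00304 — 2 statements merged into one kernel-verified Lean document; each statement's English description precedes it below -/
import Mathlib

section
/- Let K be a field, σ a finite type of indeterminates, and fix an admissible monomial order ≼ on σ →₀ ℕ. Let G be a finite set of polynomials in MvPolynomial σ K. Then G is a Gröbner basis (i.e., the reduction relation →_G is confluent) if and only if for all f, g ∈ G the S-polynomial spoly(f,g) reduces to 0 modulo G, i.e., spoly(f,g) →*_G 0. -/
open MvPolynomial Relation

/-- An admissible monomial order on `σ →₀ ℕ`: a linear order such that `0` is the
smallest element and which is compatible with addition. -/
structure AdmissibleOrder (σ : Type*) where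
  le : (σ →₀ ℕ) → (σ →₀ ℕ) → Prop
  total : ∀ s t, le s t ∨ le t s
  refl : ∀ t, le t t
  trans : ∀ s t u, le s t → le t u → le s u
  antisymm : ∀ s t, le s t → le t s → s = t
  zero_le : ∀ t, le 0 t
  add_right : ∀ s t u, le s t → le (s + u) (t + u)

namespace AdmissibleOrder

variable {σ : Type*} {K : Type*} [Field K]

/-- The strict part of an admissible order. -/
def lt (m : AdmissibleOrder σ) (s t : σ →₀ ℕ) : Prop := m.le s t ∧ s ≠ t

-- The leading monomial of a polynomial: the `m.le`-largest element of its support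
-- (`0` for the zero polynomial).
open Classical in
noncomputable def lm (m : AdmissibleOrder σ) (p : MvPolynomial σ K) : σ →₀ ℕ :=
  if h : ∃ v, v ∈ p.support ∧ ∀ u ∈ p.support, m.le u v then h.choose else 0

/-- The leading coefficient of a polynomial. -/
noncomputable def lc (m : AdmissibleOrder σ) (p : MvPolynomial σ K) : K :=
  coeff (m.lm p) p

/-- One-step polynomial reduction modulo a set `F`. -/
def Red (m : AdmissibleOrder σ) (F : Set (MvPolynomial σ K))
    (p q : MvPolynomial σ K) : Prop :=
  ∃ f ∈ F, f ≠ 0 ∧ ∃ t : σ →₀ ℕ,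
    coeff (t + m.lm f) p ≠ 0 ∧
    q = p - (coeff (t + m.lm f) p / m.lc f) • (monomial t (1 : K)) * f

/-- A set `G` is a Gröbner basis iff the reduction relation modulo `G` is confluent. -/
def IsGroebner (m : AdmissibleOrder σ) (G : Set (MvPolynomial σ K)) : Prop :=
  ∀ a b c : MvPolynomial σ K, ReflTransGen (m.Red G) a b → ReflTransGen (m.Red G) a c →
    ∃ d, ReflTransGen (m.Red G) b d ∧ ReflTransGen (m.Red G) c d

-- The S-polynomial of two polynomials.
open Classical in
noncomputable def spoly (m : AdmissibleOrder σ) (p q : MvPolynomial σ K) :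
    MvPolynomial σ K :=
  if p = 0 ∨ q = 0 then 0 else
    (monomial (m.lm p ⊔ m.lm q - m.lm p) (1 / m.lc p)) * p -
    (monomial (m.lm p ⊔ m.lm q - m.lm q) (1 / m.lc q)) * q

end AdmissibleOrder

theorem Relation.join_of_wellFounded_of_locally_confluent {α : Type*} {r : α → α → Prop}
    (hwf : WellFounded (Function.swap r))
    (h : ∀ a b c, r a b → r a c → Join (ReflTransGen r) b c) (a : α) :
    ∀ b c, ReflTransGen r a b → ReflTransGen r a c → Join (ReflTransGen r) b c := by
  induction a using hwf.induction with
  | _ a ih =>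
    intro b c hab hac
    obtain rfl | ⟨b', hab', hb'b⟩ := hab.cases_head
    · exact ⟨c, hac, .refl⟩
    obtain rfl | ⟨c', hac', hc'c⟩ := hac.cases_head
    · exact ⟨b, .refl, hab⟩
    obtain ⟨d, hb'd, hc'd⟩ := h a b' c' hab' hac'
    obtain ⟨e, hbe, hde⟩ := ih b' hab' b d hb'b hb'd
    obtain ⟨k, hek, hck⟩ := ih c' hac' e c (hc'd.trans hde) hc'c
    exact ⟨k, hbe.trans hek, hck⟩

namespace AdmissibleOrder

variable {σ K : Type*} [Field K] (m : AdmissibleOrder σ)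

theorem exists_le_of_nonempty (s : Finset (σ →₀ ℕ)) (hs : s.Nonempty) :
    ∃ v ∈ s, ∀ u ∈ s, m.le u v := by
  induction hs using Finset.Nonempty.cons_induction with
  | singleton a => exact ⟨a, by simp, by simpa using m.refl a⟩
  | cons a s ha hs ih =>
    obtain ⟨v, hv, hmax⟩ := ih
    rcases m.total a v with h | h
    · refine ⟨v, by simp [hv], fun u hu ↦ ?_⟩
      rcases Finset.mem_cons.1 hu with rfl | hu
      exacts [h, hmax u hu]
    · refine ⟨a, by simp, fun u hu ↦ ?_⟩
      rcases Finset.mem_cons.1 hu with rfl | hu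
      exacts [m.refl u, m.trans _ _ _ (hmax u hu) h]

theorem lm_spec {p : MvPolynomial σ K} (hp : p ≠ 0) :
    m.lm p ∈ p.support ∧ ∀ u ∈ p.support, m.le u (m.lm p) := by
  have h := m.exists_le_of_nonempty p.support (by simpa using hp)
  rw [lm, dif_pos h]
  exact h.choose_spec

theorem lc_ne_zero {p : MvPolynomial σ K} (hp : p ≠ 0) : m.lc p ≠ 0 :=
  mem_support_iff.1 (m.lm_spec hp).1

theorem le_of_le {s t : σ →₀ ℕ} (h : s ≤ t) : m.le s t := by
  have := m.add_right 0 (t - s) s (m.zero_le _)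
  rwa [zero_add, tsub_add_cancel_of_le h] at this

theorem wellFounded_lt [Finite σ] : WellFounded m.lt := by
  have : IsPreorder _ m.le := { refl := m.refl, trans := m.trans }
  have hwqo : WellQuasiOrdered m.le := fun f ↦
    let ⟨i, j, hij, h⟩ := wellQuasiOrdered_le f
    ⟨i, j, hij, m.le_of_le h⟩
  exact Subrelation.wf (fun {s t} h ↦ ⟨h.1, fun h' ↦ h.2 (m.antisymm _ _ h.1 h')⟩)
    hwqo.wellFounded

/-- Cancel the monomial `t + lm f` of `p` by subtracting a multiple of `f`. -/
noncomputable def cancel (f : MvPolynomial σ K) (t : σ →₀ ℕ) (p : MvPolynomial σ K) :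
    MvPolynomial σ K :=
  p - (coeff (t + m.lm f) p / m.lc f) • (monomial t (1 : K)) * f

variable {m}

theorem cancel_add (f : MvPolynomial σ K) (t : σ →₀ ℕ) (p q : MvPolynomial σ K) :
    m.cancel f t (p + q) = m.cancel f t p + m.cancel f t q := by
  simp only [cancel, coeff_add, add_div, add_smul]
  ring

theorem cancel_sub (f : MvPolynomial σ K) (t : σ →₀ ℕ) (p q : MvPolynomial σ K) :
    m.cancel f t (p - q) = m.cancel f t p - m.cancel f t q := by
  simp only [cancel, coeff_sub, sub_div, sub_smul]
  ring

theorem cancel_eq_self {f p : MvPolynomial σ K} {t : σ →₀ ℕ} (h : coeff (t + m.lm f) p = 0) :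
    m.cancel f t p = p := by
  simp [cancel, h]

theorem coeff_cancel {f : MvPolynomial σ K} (hf : f ≠ 0) (t : σ →₀ ℕ) (p : MvPolynomial σ K) :
    coeff (t + m.lm f) (m.cancel f t p) = 0 := by
  rw [cancel, coeff_sub, smul_mul_assoc, coeff_smul, coeff_monomial_mul, one_mul]
  change _ - (_ / m.lc f) • m.lc f = 0
  rw [smul_eq_mul, div_mul_cancel₀ _ (m.lc_ne_zero hf), sub_self]

theorem coeff_cancel_of_lt {f : MvPolynomial σ K} (hf : f ≠ 0) {t u : σ →₀ ℕ}
    (p : MvPolynomial σ K) (h : m.lt (t + m.lm f) u) :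
    coeff u (m.cancel f t p) = coeff u p := by
  rw [cancel, coeff_sub, smul_mul_assoc, coeff_smul, coeff_monomial_mul', sub_eq_self]
  split_ifs with htu
  · by_contra hne
    have hmem : u - t ∈ f.support := by
      rw [mem_support_iff]
      intro h0
      simp [h0] at hne
    have hle := m.add_right _ _ t ((m.lm_spec hf).2 _ hmem)
    rw [tsub_add_cancel_of_le htu, add_comm] at hle
    exact h.2 (m.antisymm _ _ h.1 hle)
  · simp

variable {G : Set (MvPolynomial σ K)}

theorem red_iff {p q : MvPolynomial σ K} :
    m.Red G p q ↔ ∃ f ∈ G, f ≠ 0 ∧ ∃ t, coeff (t + m.lm f) p ≠ 0 ∧ q = m.cancel f t p :=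
  Iff.rfl

theorem reflTransGen_cancel {f : MvPolynomial σ K} (hfG : f ∈ G) (hf : f ≠ 0) (t : σ →₀ ℕ)
    (p : MvPolynomial σ K) : ReflTransGen (m.Red G) p (m.cancel f t p) := by
  by_cases h : coeff (t + m.lm f) p = 0
  · rw [cancel_eq_self h]
  · exact .single ⟨f, hfG, hf, t, h, rfl⟩

theorem Red.join_add {p q : MvPolynomial σ K} (h : m.Red G p q) (r : MvPolynomial σ K) :
    Join (ReflTransGen (m.Red G)) (p + r) (q + r) := by
  obtain ⟨f, hfG, hf, t, -, rfl⟩ := red_iff.1 h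
  refine ⟨_, reflTransGen_cancel hfG hf t _, ?_⟩
  convert reflTransGen_cancel hfG hf t (m.cancel f t p + r) using 1
  rw [cancel_add, cancel_add, cancel_eq_self (coeff_cancel hf t p)]

theorem join_of_reflTransGen_sub {h z : MvPolynomial σ K} (hz : ReflTransGen (m.Red G) h z)
    (hz0 : z = 0) (p q : MvPolynomial σ K) (hpq : p - q = h) :
    Join (ReflTransGen (m.Red G)) p q := by
  induction hz using ReflTransGen.head_induction_on generalizing p q with
  | refl => exact ⟨p, .refl, by rw [sub_eq_zero.1 (hpq.trans hz0)]⟩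
  | head hstep _ ih =>
    obtain ⟨f, hfG, hf, t, -, rfl⟩ := red_iff.1 hstep
    obtain ⟨d, hpd, hqd⟩ := ih (m.cancel f t p) (m.cancel f t q) (by rw [← hpq, cancel_sub])
    exact ⟨d, (reflTransGen_cancel hfG hf t p).trans hpd,
      (reflTransGen_cancel hfG hf t q).trans hqd⟩

theorem Red.monomial_mul {p q : MvPolynomial σ K} (h : m.Red G p q) (u : σ →₀ ℕ) {c : K}
    (hc : c ≠ 0) : m.Red G (monomial u c * p) (monomial u c * q) := by
  obtain ⟨f, hfG, hf, t, ht, rfl⟩ := h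
  refine ⟨f, hfG, hf, u + t, ?_, ?_⟩
  · rw [add_assoc, coeff_monomial_mul]
    exact mul_ne_zero hc ht
  · rw [add_assoc, coeff_monomial_mul, mul_sub, ← mul_assoc]
    congr 2
    rw [smul_monomial, smul_monomial, MvPolynomial.monomial_mul, smul_eq_mul, smul_eq_mul]
    congr 1
    ring

theorem reflTransGen_monomial_mul {p q : MvPolynomial σ K} (h : ReflTransGen (m.Red G) p q)
    (u : σ →₀ ℕ) {c : K} (hc : c ≠ 0) :
    ReflTransGen (m.Red G) (monomial u c * p) (monomial u c * q) :=
  h.lift _ fun _ _ h ↦ h.monomial_mul u hc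

theorem not_red_zero (q : MvPolynomial σ K) : ¬ m.Red G 0 q := by
  rintro ⟨f, -, -, t, h, -⟩
  simp at h

theorem wellFounded_red [Finite σ] : WellFounded (Function.swap (m.Red G)) := by
  have hs : WellFounded fun a b : K ↦ a = 0 ∧ b ≠ 0 := by
    have h0 : ∀ a : K, a = 0 → Acc (fun a b : K ↦ a = 0 ∧ b ≠ 0) a :=
      fun a ha ↦ ⟨_, fun b hb ↦ absurd ha hb.2⟩
    exact ⟨fun a ↦ ⟨_, fun b hb ↦ h0 b hb.1⟩⟩
  have : Std.Trichotomous (Function.swap m.lt) := ⟨fun s t h₁ h₂ ↦ by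
    by_contra hne
    rcases m.total s t with h | h
    exacts [h₂ ⟨h, hne⟩, h₁ ⟨h, Ne.symm hne⟩]⟩
  have hlex := Finsupp.Lex.wellFounded' (r := Function.swap m.lt)
    (s := fun a b : K ↦ a = 0 ∧ b ≠ 0) (fun _ h ↦ h.2 rfl) hs m.wellFounded_lt
  refine Subrelation.wf (fun {q p} h ↦ ?_)
    (InvImage.wf (fun p : MvPolynomial σ K ↦ AddMonoidAlgebra.coeff p) hlex)
  obtain ⟨f, -, hf, t, ht, rfl⟩ := red_iff.1 h
  exact ⟨t + m.lm f, fun u hu ↦ coeff_cancel_of_lt hf p hu, coeff_cancel hf t p, ht⟩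

theorem cancel_sub_cancel_eq_spoly {f g : MvPolynomial σ K} (hf : f ≠ 0) (hg : g ≠ 0)
    {t u : σ →₀ ℕ} (h : t + m.lm f = u + m.lm g) (p : MvPolynomial σ K) :
    m.cancel f t p - m.cancel g u p =
      monomial (t + m.lm f - m.lm f ⊔ m.lm g) (-coeff (t + m.lm f) p) * m.spoly f g := by
  have ht : t + m.lm f - m.lm f ⊔ m.lm g + (m.lm f ⊔ m.lm g - m.lm f) = t := by
    ext i
    have := DFunLike.congr_fun h i
    simp only [Finsupp.add_apply, Finsupp.tsub_apply, Finsupp.sup_apply] at this ⊢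
    omega
  have hu : t + m.lm f - m.lm f ⊔ m.lm g + (m.lm f ⊔ m.lm g - m.lm g) = u := by
    ext i
    have := DFunLike.congr_fun h i
    simp only [Finsupp.add_apply, Finsupp.tsub_apply, Finsupp.sup_apply] at this ⊢
    omega
  rw [spoly, if_neg (by simp [hf, hg]), mul_sub, ← mul_assoc, ← mul_assoc, monomial_mul,
    monomial_mul, ht, hu, cancel, cancel, ← h, smul_monomial, smul_monomial]
  simp only [smul_eq_mul, mul_one, mul_one_div, neg_div, map_neg]
  ring

theorem join_cancel_of_lt {f g : MvPolynomial σ K} (hfG : f ∈ G) (hf : f ≠ 0) (hgG : g ∈ G)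
    (hg : g ≠ 0) {t u : σ →₀ ℕ} (h : m.lt (u + m.lm g) (t + m.lm f)) {p : MvPolynomial σ K}
    (hp : coeff (u + m.lm g) p ≠ 0) :
    Join (ReflTransGen (m.Red G)) (m.cancel f t p) (m.cancel g u p) := by
  have hred : m.Red G p (m.cancel g u p) := ⟨g, hgG, hg, u, hp, rfl⟩
  obtain ⟨d, h₁, h₂⟩ := hred.join_add (m.cancel f t p - p)
  refine ⟨d, by simpa using h₁, (reflTransGen_cancel hfG hf t _).trans ?_⟩
  convert h₂ using 1
  rw [cancel.eq_1 m f t (m.cancel g u p), cancel.eq_1 m f t p, coeff_cancel_of_lt hg p h]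
  ring

theorem isGroebner_of_spoly [Finite σ]
    (h : ∀ f ∈ G, ∀ g ∈ G, ReflTransGen (m.Red G) (m.spoly f g) 0) : m.IsGroebner G := by
  intro a b c
  refine join_of_wellFounded_of_locally_confluent wellFounded_red (fun p q₁ q₂ h₁ h₂ ↦ ?_) a b c
  obtain ⟨f, hfG, hf, t, ht, rfl⟩ := red_iff.1 h₁
  obtain ⟨g, hgG, hg, u, hu, rfl⟩ := red_iff.1 h₂
  by_cases heq : t + m.lm f = u + m.lm g
  · refine join_of_reflTransGen_sub ?_ rfl _ _ (cancel_sub_cancel_eq_spoly hf hg heq p)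
    simpa using reflTransGen_monomial_mul (h f hfG g hgG) (t + m.lm f - m.lm f ⊔ m.lm g)
      (neg_ne_zero.2 ht)
  · rcases m.total (t + m.lm f) (u + m.lm g) with hle | hle
    · exact Join.symm.symm _ _ (join_cancel_of_lt hgG hg hfG hf ⟨hle, heq⟩ ht)
    · exact join_cancel_of_lt hfG hf hgG hg ⟨hle, Ne.symm heq⟩ hu

theorem IsGroebner.join_add (hG : m.IsGroebner G) {p q : MvPolynomial σ K}
    (h : ReflTransGen (m.Red G) p q) (r : MvPolynomial σ K) :
    Join (ReflTransGen (m.Red G)) (p + r) (q + r) := by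
  have htrans := @(isTrans_join fun a b c ↦ hG a b c).trans
  induction h with
  | refl => exact ⟨_, .refl, .refl⟩
  | tail _ hstep ih => exact htrans _ _ _ ih (hstep.join_add r)

theorem IsGroebner.reflTransGen_sub (hG : m.IsGroebner G) {a b c : MvPolynomial σ K}
    (hb : ReflTransGen (m.Red G) a b) (hc : ReflTransGen (m.Red G) a c) :
    ReflTransGen (m.Red G) (c - b) 0 := by
  have htrans := @(isTrans_join fun a b c ↦ hG a b c).trans
  obtain ⟨d, hd, h0⟩ := htrans _ _ _ (Join.symm.symm _ _ (hG.join_add hc (-b))) (hG.join_add hb (-b))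
  rw [add_neg_cancel] at h0
  obtain rfl | ⟨e, he, -⟩ := h0.cases_head
  · rwa [← sub_eq_add_neg] at hd
  · exact absurd he (not_red_zero e)

open Classical in
theorem IsGroebner.spoly (hG : m.IsGroebner G) {f g : MvPolynomial σ K} (hfG : f ∈ G)
    (hgG : g ∈ G) : ReflTransGen (m.Red G) (m.spoly f g) 0 := by
  by_cases h : f = 0 ∨ g = 0
  · rw [AdmissibleOrder.spoly, if_pos h]
  obtain ⟨hf, hg⟩ := not_or.1 h
  set l := m.lm f ⊔ m.lm g with hl
  have hlf : l - m.lm f + m.lm f = l := tsub_add_cancel_of_le le_sup_left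
  have hlg : l - m.lm g + m.lm g = l := tsub_add_cancel_of_le le_sup_right
  have hsub := cancel_sub_cancel_eq_spoly hf hg (hlf.trans hlg.symm) (monomial l (-1 : K))
  rw [hlf, ← hl, tsub_self, coeff_monomial, if_pos rfl, neg_neg, monomial_zero', C_1,
    one_mul] at hsub
  rw [← hsub]
  exact hG.reflTransGen_sub (reflTransGen_cancel hgG hg _ _) (reflTransGen_cancel hfG hf _ _)

end AdmissibleOrder

/-- Buchberger's theorem: a finite set `G` is a Gröbner basis iff all S-polynomials of
elements of `G` reduce to `0` modulo `G`. -/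
theorem buchberger_theorem {σ K : Type*} [Fintype σ] [Field K] (m : AdmissibleOrder σ)
    (G : Set (MvPolynomial σ K)) (hG : G.Finite) :
    m.IsGroebner G ↔
      ∀ f ∈ G, ∀ g ∈ G, Relation.ReflTransGen (m.Red G) (m.spoly f g) 0 :=
  ⟨fun h _ hf _ hg ↦ h.spoly hf hg, AdmissibleOrder.isGroebner_of_spoly⟩
end

section
/- Let K be a field, σ a type of indeterminates, and fix an admissible monomial order ≼ on σ →₀ ℕ. For any set F ⊆ MvPolynomial σ K and any polynomial p, if p →*_F 0 then p belongs to the ideal generated by F. -/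
open MvPolynomial Relation

/-- If `p` reduces to `0` modulo `F`, then `p` lies in the ideal generated by `F`. -/
theorem mem_span_of_red_zero {σ K : Type*} [Field K] (m : AdmissibleOrder σ)
    (F : Set (MvPolynomial σ K)) (p : MvPolynomial σ K)
    (h : Relation.ReflTransGen (m.Red F) p 0) :
    p ∈ Ideal.span F := by
  induction h using ReflTransGen.head_induction_on with
  | refl => exact zero_mem _
  | head hpq _ hq =>
    obtain ⟨f, hf, -, t, -, rfl⟩ := hpq
    exact (Submodule.sub_mem_iff_left _
      (Ideal.mul_mem_left _ _ (Ideal.subset_span hf))).mp hq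
end
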